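/- Let $f : \mathbb{R} \to \mathbb{R}$ be twice continuously differentiable, $a < b$, $T > 0$, and let $u$ be a real-valued function that is twice continuously differentiable on the closed rectangle $[0,T] \times [a,b]$ (with one-sided derivatives at its edges) and satisfies $\partial_t u + f'(u)\, \partial_x u = 0$ there. Define the boundary trace $g(t) = u(t,a)$ for $t \in [0,T]$, and suppose $f'(g(t)) \neq 0$ for all $t \in [0,T]$. Then for all $t \in (0,T)$, the second (one-sided, from within $[a,b]$) spatial derivative at the boundary satisfies $$\partial_x^2 u(t,a) = - \frac{2 f''(g(t))\, g'(t)^2 - f'(g(t))\, g''(t)}{\bigl(f'(g(t))\bigr)^3}.$$ -/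

import Mathlib

open Set

theorem HasFDerivWithinAt.hasDerivWithinAt_slice_fst {E : Type*} [NormedAddCommGroup E]
    [NormedSpace ℝ E] {F : ℝ × ℝ → E} {L : ℝ × ℝ →L[ℝ] E} {I J : Set ℝ} {t x : ℝ}
    (h : HasFDerivWithinAt F L (I ×ˢ J) (t, x)) (hx : x ∈ J) :
    HasDerivWithinAt (fun s => F (s, x)) (L (1, 0)) I t :=
  h.comp_hasDerivWithinAt (f := fun s : ℝ => (s, x)) t
    ((hasDerivWithinAt_id t I).prodMk (hasDerivWithinAt_const t I x)) fun _ hs => ⟨hs, hx⟩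

theorem HasFDerivWithinAt.hasDerivWithinAt_slice_snd {E : Type*} [NormedAddCommGroup E]
    [NormedSpace ℝ E] {F : ℝ × ℝ → E} {L : ℝ × ℝ →L[ℝ] E} {I J : Set ℝ} {t x : ℝ}
    (h : HasFDerivWithinAt F L (I ×ˢ J) (t, x)) (ht : t ∈ I) :
    HasDerivWithinAt (fun y => F (t, y)) (L (0, 1)) J x :=
  h.comp_hasDerivWithinAt (f := fun y : ℝ => (t, y)) x
    ((hasDerivWithinAt_const x J t).prodMk (hasDerivWithinAt_id x J)) fun _ hy => ⟨ht, hy⟩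

/-- At the upwind boundary, the second spatial derivative of a smooth solution of the
scalar conservation law on `[0,T] × [a,b]` is determined by the boundary data:
`uₓₓ(t,a) = -(2 f''(g) g'² - f'(g) g'') / (f'(g))³`. All derivatives of `u` are taken within the
closed rectangle, i.e. they are one-sided at its edges, so that the values of `u` outside the
rectangle play no role; `g` is differentiated at interior points of `[0,T]` only. -/
theorem boundary_second_spatial_derivative
    (f : ℝ → ℝ) (hf : ContDiff ℝ 2 f) (a b T : ℝ) (hab : a < b) (hT : 0 < T)
    (u : ℝ × ℝ → ℝ)
    (hu : ContDiffOn ℝ 2 u (Icc 0 T ×ˢ Icc a b))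
    (hpde : ∀ t ∈ Icc (0 : ℝ) T, ∀ x ∈ Icc a b,
      derivWithin (fun s => u (s, x)) (Icc 0 T) t
        + deriv f (u (t, x)) * derivWithin (fun y => u (t, y)) (Icc a b) x = 0)
    (g : ℝ → ℝ) (hg : ∀ t ∈ Icc (0 : ℝ) T, g t = u (t, a))
    (hf' : ∀ t ∈ Icc (0 : ℝ) T, deriv f (g t) ≠ 0) :
    ∀ t ∈ Ioo (0 : ℝ) T,
      iteratedDerivWithin 2 (fun y => u (t, y)) (Icc a b) a
        = -(2 * iteratedDeriv 2 f (g t) * (deriv g t) ^ 2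
            - deriv f (g t) * iteratedDeriv 2 g t) / (deriv f (g t)) ^ 3 := by
  intro t ht
  have hI := uniqueDiffOn_Icc hT
  have hJ := uniqueDiffOn_Icc hab
  have hS := hI.prod hJ
  have htI : t ∈ Icc 0 T := Ioo_subset_Icc_self ht
  have haJ : a ∈ Icc a b := left_mem_Icc.2 hab.le
  have hz : (t, a) ∈ Icc 0 T ×ˢ Icc a b := ⟨htI, haJ⟩
  set S := Icc 0 T ×ˢ Icc a b with hSdef
  set D := fderivWithin ℝ u S with hD
  have huD : ∀ z ∈ S, HasFDerivWithinAt u (D z) S z := fun z hz =>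
    (hu.differentiableOn two_ne_zero z hz).hasFDerivWithinAt
  have hDC : ContDiffOn ℝ 1 D S := hu.fderivWithin hS (by norm_num)
  set D₂ := fderivWithin ℝ D S (t, a) with hD₂
  have hDD : HasFDerivWithinAt D D₂ S (t, a) :=
    (hDC.differentiableOn one_ne_zero _ hz).hasFDerivWithinAt
  have hDv : ∀ v, HasFDerivWithinAt (fun z => D z v)
      ((ContinuousLinearMap.apply ℝ ℝ v).comp D₂) S (t, a) := fun v =>
    (ContinuousLinearMap.apply ℝ ℝ v).hasFDerivAt.comp_hasFDerivWithinAt (t, a) hDD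
  have hsymm : D₂ (1, 0) (0, 1) = D₂ (0, 1) (1, 0) := by
    refine (hu (t, a) hz).isSymmSndFDerivWithinAt (by simp) hS ?_ hz (1, 0) (0, 1)
    rw [hSdef, interior_prod_eq, closure_prod_eq, interior_Icc, interior_Icc,
      closure_Ioo hT.ne, closure_Ioo hab.ne]
    exact hz
  have hut : ∀ s ∈ Icc 0 T, ∀ y ∈ Icc a b,
      derivWithin (fun s => u (s, y)) (Icc 0 T) s = D (s, y) (1, 0) := fun s hs y hy =>
    ((huD (s, y) ⟨hs, hy⟩).hasDerivWithinAt_slice_fst hy).derivWithin (hI s hs)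
  have hux : ∀ s ∈ Icc 0 T, ∀ y ∈ Icc a b,
      derivWithin (fun y => u (s, y)) (Icc a b) y = D (s, y) (0, 1) := fun s hs y hy =>
    ((huD (s, y) ⟨hs, hy⟩).hasDerivWithinAt_slice_snd hs).derivWithin (hJ y hy)
  have hpdeD : ∀ z ∈ S, D z (1, 0) + deriv f (u z) * D z (0, 1) = 0 := by
    rintro ⟨s, y⟩ ⟨hs, hy⟩
    simpa only [hut s hs y hy, hux s hs y hy] using hpde s hs y hy
  have huxx : iteratedDerivWithin 2 (fun y => u (t, y)) (Icc a b) a = D₂ (0, 1) (0, 1) := by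
    rw [iteratedDerivWithin_succ, iteratedDerivWithin_one,
      derivWithin_congr (fun y hy => hux t htI y hy) (hux t htI a haJ)]
    exact ((hDv (0, 1)).hasDerivWithinAt_slice_snd htI).derivWithin (hJ a haJ)
  have hg' : ∀ s ∈ Ioo 0 T, deriv g s = D (s, a) (1, 0) := by
    intro s hs
    have hsI := Ioo_subset_Icc_self hs
    rw [← derivWithin_of_mem_nhds (Icc_mem_nhds hs.1 hs.2), derivWithin_congr hg (hg s hsI),
      hut s hsI a haJ]
  have hg'' : iteratedDeriv 2 g t = D₂ (1, 0) (1, 0) := by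
    rw [iteratedDeriv_succ, iteratedDeriv_one]
    refine HasDerivAt.deriv (HasDerivAt.congr_of_eventuallyEq
      (((hDv (1, 0)).hasDerivWithinAt_slice_fst haJ).hasDerivAt (Icc_mem_nhds ht.1 ht.2)) ?_)
    filter_upwards [Ioo_mem_nhds ht.1 ht.2] with s hs using hg' s hs
  have hf₂ : HasDerivAt (deriv f) (iteratedDeriv 2 f (u (t, a))) (u (t, a)) := by
    rw [iteratedDeriv_succ, iteratedDeriv_one]
    exact (hf.differentiable_deriv_two _).hasDerivAt
  have hres := (hDv (1, 0)).add
    ((hf₂.comp_hasFDerivWithinAt (t, a) (huD _ hz)).mul (hDv (0, 1)))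
  have hzero := (hS _ hz).eq hres
    ((hasFDerivWithinAt_const (0 : ℝ) (t, a) S).congr hpdeD (hpdeD _ hz))
  have hdt := DFunLike.congr_fun hzero (1, 0)
  have hdx := DFunLike.congr_fun hzero (0, 1)
  simp only [Function.comp_apply, add_apply, ContinuousLinearMap.comp_apply,
    ContinuousLinearMap.apply_apply, smul_apply, smul_eq_mul, zero_apply] at hdt hdx
  have h0 := hpdeD _ hz
  have hne := hf' t htI
  rw [huxx, hg'', hg' t ht]
  rw [hg t htI] at hne ⊢
  rw [hsymm] at hdt
  rw [eq_div_iff (pow_ne_zero 3 hne)]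
  linear_combination deriv f (u (t, a)) ^ 2 * hdx - deriv f (u (t, a)) * hdt +
    iteratedDeriv 2 f (u (t, a)) *
      (2 * D (t, a) (1, 0) - deriv f (u (t, a)) * D (t, a) (0, 1)) * h0
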